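/- arXiv:1606.06386 — 7 statements merged into one kernel-verified Lean document; each statement's English description precedes it below -/
import Mathlib

section
/- Let f : ℝ → ℝ and let g be a modulus of uniform continuity for f on [0,1]. Let k ≥ 1 be a natural number, let π be a tagged partition of [0,1] with mesh ‖π‖ < 1/g(k), and let π' be any tagged partition of [0,1] that refines π. Then |S_π(f) − S_{π'}(f)| ≤ 1/k. -/
/-- A tagged partition of `[0,1]`: points `0 = x 0 ≤ x 1 ≤ … ≤ x M = 1`
with tags `t i ∈ [x i, x (i+1)]` for `i < M`. -/
structure TaggedPartition where
  M : ℕ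
  x : ℕ → ℝ
  t : ℕ → ℝ
  hM : 0 < M
  hx0 : x 0 = 0
  hxM : x M = 1
  mono : ∀ i < M, x i ≤ x (i + 1)
  tag : ∀ i < M, x i ≤ t i ∧ t i ≤ x (i + 1)

/-- The mesh `‖π‖ = max_{i<M} (x (i+1) - x i)`. -/
noncomputable def mesh (π : TaggedPartition) : ℝ :=
  (Finset.range π.M).sup' (Finset.nonempty_range_iff.mpr π.hM.ne')
    (fun i => π.x (i + 1) - π.x i)

/-- The Riemann sum `S_π(f) = Σ_{i<M} f (t i) * (x (i+1) - x i)`. -/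
noncomputable def RSum (f : ℝ → ℝ) (π : TaggedPartition) : ℝ :=
  ∑ i ∈ Finset.range π.M, f (π.t i) * (π.x (i + 1) - π.x i)

/-- `π'` refines `π`: every partition point of `π` is a partition point of `π'`. -/
def Refines (π' π : TaggedPartition) : Prop :=
  ∀ i ≤ π.M, ∃ j ≤ π'.M, π'.x j = π.x i

/-- `g` is a modulus of uniform continuity for `f` on `[0,1]`. -/
def ModUC (g : ℕ → ℕ) (f : ℝ → ℝ) : Prop :=
  (∀ k, 1 ≤ g k) ∧
  ∀ k, 1 ≤ k → ∀ x ∈ Set.Icc (0 : ℝ) 1, ∀ y ∈ Set.Icc (0 : ℝ) 1,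
    |x - y| < 1 / (g k : ℝ) → |f x - f y| ≤ 1 / (k : ℝ)

namespace TaggedPartition

lemma x_le_x (π : TaggedPartition) {i j : ℕ} (hij : i ≤ j) (hj : j ≤ π.M) : π.x i ≤ π.x j := by
  induction j, hij using Nat.le_induction with
  | base => exact le_rfl
  | succ j _ ih => exact (ih (by lia)).trans (π.mono j (by lia))

lemma x_nonneg (π : TaggedPartition) {i : ℕ} (hi : i ≤ π.M) : 0 ≤ π.x i :=
  π.hx0 ▸ π.x_le_x (Nat.zero_le i) hi

lemma x_le_one (π : TaggedPartition) {i : ℕ} (hi : i ≤ π.M) : π.x i ≤ 1 :=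
  π.hxM ▸ π.x_le_x hi le_rfl

lemma sub_le_mesh (π : TaggedPartition) {i : ℕ} (hi : i < π.M) :
    π.x (i + 1) - π.x i ≤ mesh π :=
  Finset.le_sup' (fun i => π.x (i + 1) - π.x i) (Finset.mem_range.mpr hi)

lemma sum_sub_eq_one (π : TaggedPartition) :
    ∑ i ∈ Finset.range π.M, (π.x (i + 1) - π.x i) = 1 := by
  rw [Finset.sum_range_sub, π.hx0, π.hxM, sub_zero]

/-- The length of the intersection of the `i`-th interval of `π` and the `j`-th interval of `π'`. -/
noncomputable def overlap (π π' : TaggedPartition) (i j : ℕ) : ℝ :=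
  (min (π.x (i + 1)) (π'.x (j + 1)) - min (π.x i) (π'.x (j + 1))) -
    (min (π.x (i + 1)) (π'.x j) - min (π.x i) (π'.x j))

lemma overlap_comm (π π' : TaggedPartition) (i j : ℕ) :
    overlap π π' i j = overlap π' π j i := by
  simp only [overlap, min_comm (π.x _)]
  ring

lemma sum_overlap (π π' : TaggedPartition) {i : ℕ} (hi : i < π.M) :
    ∑ j ∈ Finset.range π'.M, overlap π π' i j = π.x (i + 1) - π.x i := by
  unfold overlap
  rw [Finset.sum_range_sub (fun j => min (π.x (i + 1)) (π'.x j) - min (π.x i) (π'.x j)),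
    π'.hx0, π'.hxM, min_eq_left (π.x_le_one hi), min_eq_left (π.x_le_one hi.le),
    min_eq_right (π.x_nonneg hi), min_eq_right (π.x_nonneg hi.le)]
  ring

lemma overlap_nonneg (π π' : TaggedPartition) {i j : ℕ} (hi : i < π.M) (hj : j < π'.M) :
    0 ≤ overlap π π' i j := by
  have := π.mono i hi
  have := π'.mono j hj
  unfold overlap
  grind

lemma overlap_eq_zero_of_le (π π' : TaggedPartition) {i j : ℕ} (hi : i < π.M) (hj : j < π'.M)
    (h : π.x (i + 1) ≤ π'.x j) : overlap π π' i j = 0 := by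
  have := π.mono i hi
  have := π'.mono j hj
  unfold overlap
  grind

lemma subset_of_overlap_ne_zero {π π' : TaggedPartition} (href : Refines π' π) {i j : ℕ}
    (hi : i < π.M) (hj : j < π'.M) (h : overlap π π' i j ≠ 0) :
    π.x i ≤ π'.x j ∧ π'.x (j + 1) ≤ π.x (i + 1) := by
  obtain ⟨a, ha, hax⟩ := href i hi.le
  obtain ⟨b, hb, hbx⟩ := href (i + 1) hi
  rw [← hax, ← hbx]
  constructor
  · refine π'.x_le_x (not_lt.mp fun hja => h ?_) hj.le
    rw [overlap_comm]
    exact π'.overlap_eq_zero_of_le π hj hi (hax ▸ π'.x_le_x hja ha)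
  · refine π'.x_le_x (not_lt.mp fun hbj => h ?_) hb
    exact π.overlap_eq_zero_of_le π' hi hj (hbx ▸ π'.x_le_x (Nat.lt_succ_iff.mp hbj) hj.le)

lemma RSum_eq_sum_overlap (f : ℝ → ℝ) (π π' : TaggedPartition) :
    RSum f π = ∑ i ∈ Finset.range π.M, ∑ j ∈ Finset.range π'.M, f (π.t i) * overlap π π' i j := by
  refine Finset.sum_congr rfl fun i hi => ?_
  rw [← Finset.mul_sum, sum_overlap π π' (Finset.mem_range.mp hi)]

end TaggedPartition

theorem riemann_sum_refinement (f : ℝ → ℝ) (g : ℕ → ℕ) (hg : ModUC g f)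
    (k : ℕ) (hk : 1 ≤ k) (π π' : TaggedPartition)
    (hmesh : mesh π < 1 / (g k : ℝ)) (href : Refines π' π) :
    |RSum f π - RSum f π'| ≤ 1 / (k : ℝ) := by
  have key : ∀ i ∈ Finset.range π.M, ∀ j ∈ Finset.range π'.M,
      |(f (π.t i) - f (π'.t j)) * π.overlap π' i j| ≤ 1 / (k : ℝ) * π.overlap π' i j := by
    intro i hi j hj
    rw [Finset.mem_range] at hi hj
    by_cases h : π.overlap π' i j = 0
    · simp [h]
    obtain ⟨hl, hr⟩ := TaggedPartition.subset_of_overlap_ne_zero href hi hj h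
    obtain ⟨h1, h2⟩ := π.tag i hi
    obtain ⟨h3, h4⟩ := π'.tag j hj
    have h0 := π.x_nonneg hi.le
    have h5 := π.x_le_one hi
    have hm := π.sub_le_mesh hi
    have hw := π.overlap_nonneg π' hi hj
    rw [abs_mul, abs_of_nonneg hw]
    refine mul_le_mul_of_nonneg_right (hg.2 k hk _ ⟨?_, ?_⟩ _ ⟨?_, ?_⟩ ?_) hw
    any_goals linarith
    rw [abs_lt]
    constructor <;> linarith
  have hπ' : RSum f π' = ∑ i ∈ Finset.range π.M, ∑ j ∈ Finset.range π'.M,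
      f (π'.t j) * π.overlap π' i j := by
    rw [TaggedPartition.RSum_eq_sum_overlap f π' π, Finset.sum_comm]
    simp only [π.overlap_comm π']
  calc |RSum f π - RSum f π'|
      = |∑ i ∈ Finset.range π.M, ∑ j ∈ Finset.range π'.M,
          (f (π.t i) - f (π'.t j)) * π.overlap π' i j| := by
        rw [TaggedPartition.RSum_eq_sum_overlap f π π', hπ']
        simp only [sub_mul, Finset.sum_sub_distrib]
    _ ≤ ∑ i ∈ Finset.range π.M, ∑ j ∈ Finset.range π'.M, 1 / (k : ℝ) * π.overlap π' i j :=
        (Finset.abs_sum_le_sum_abs _ _).trans <| Finset.sum_le_sum fun i hi =>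
          (Finset.abs_sum_le_sum_abs _ _).trans <| Finset.sum_le_sum (key i hi)
    _ = 1 / (k : ℝ) * ∑ i ∈ Finset.range π.M, (π.x (i + 1) - π.x i) := by
        rw [Finset.mul_sum]
        refine Finset.sum_congr rfl fun i hi => ?_
        rw [← Finset.mul_sum, π.sum_overlap π' (Finset.mem_range.mp hi)]
    _ = 1 / (k : ℝ) := by rw [π.sum_sub_eq_one, mul_one]
end

section
/- Let f : ℝ → ℝ and let g be a modulus of uniform continuity for f on [0,1]. Then for every natural number n ≥ 1 and any two tagged partitions π, π' of [0,1] with mesh ‖π‖ < 1/g(2n) and ‖π'‖ < 1/g(2n), one has |S_π(f) − S_{π'}(f)| ≤ 1/n. (This is the effective version CRI_ef(t) of the statement 'a uniformly continuous function on the unit interval is Riemann integrable', with the extracted modulus of Riemann integration t(g)(n) = g(2n).) -/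
theorem TaggedPartition.x_mem_Icc (π : TaggedPartition) {i : ℕ} (hi : i ≤ π.M) :
    π.x i ∈ Set.Icc (0 : ℝ) 1 := by
  have hmono : MonotoneOn π.x (Set.Iic π.M) :=
    monotoneOn_of_le_add_one Set.ordConnected_Iic fun i _ _ h => π.mono i h
  constructor
  · rw [← π.hx0]
    exact hmono (Set.mem_Iic.mpr (Nat.zero_le _)) hi (Nat.zero_le _)
  · rw [← π.hxM]
    exact hmono hi (Set.mem_Iic.mpr le_rfl) hi

theorem TaggedPartition.sub_le_mesh_s1 (π : TaggedPartition) {i : ℕ} (hi : i < π.M) :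
    π.x (i + 1) - π.x i ≤ mesh π :=
  Finset.le_sup' (fun i => π.x (i + 1) - π.x i) (Finset.mem_range.mpr hi)

theorem ModUC.continuousOn {g : ℕ → ℕ} {f : ℝ → ℝ} (hg : ModUC g f) :
    ContinuousOn f (Set.Icc 0 1) := by
  rw [Metric.continuousOn_iff]
  intro b hb ε hε
  obtain ⟨k, hk⟩ := exists_nat_one_div_lt hε
  have hpos : (0 : ℝ) < g (k + 1) := by exact_mod_cast hg.1 (k + 1)
  refine ⟨1 / (g (k + 1) : ℝ), by positivity, fun a ha hab => ?_⟩
  have h := hg.2 (k + 1) (Nat.le_add_left 1 k) a ha b hb hab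
  push_cast at h
  exact h.trans_lt hk

/-- A Riemann sum of mesh below `1 / g k` is within `1 / k` of the integral. -/
theorem ModUC.abs_RSum_sub_integral_le {g : ℕ → ℕ} {f : ℝ → ℝ} (hg : ModUC g f) {k : ℕ}
    (hk : 1 ≤ k) (π : TaggedPartition) (hπ : mesh π < 1 / (g k : ℝ)) :
    |RSum f π - ∫ y in (0 : ℝ)..1, f y| ≤ 1 / (k : ℝ) := by
  have hsub : ∀ i < π.M, Set.Icc (π.x i) (π.x (i + 1)) ⊆ Set.Icc 0 1 := fun i hi =>
    Set.Icc_subset_Icc (π.x_mem_Icc hi.le).1 (π.x_mem_Icc (Nat.succ_le_of_lt hi)).2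
  have hint : ∀ i < π.M, IntervalIntegrable f MeasureTheory.volume (π.x i) (π.x (i + 1)) :=
    fun i hi => (hg.continuousOn.mono (hsub i hi)).intervalIntegrable_of_Icc (π.mono i hi)
  have hsum := intervalIntegral.sum_integral_adjacent_intervals hint
  rw [π.hx0, π.hxM] at hsum
  rw [← hsum, RSum, ← Finset.sum_sub_distrib]
  have hterm : ∀ i ∈ Finset.range π.M,
      |f (π.t i) * (π.x (i + 1) - π.x i) - ∫ y in π.x i..π.x (i + 1), f y| ≤
        1 / (k : ℝ) * (π.x (i + 1) - π.x i) := by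
    intro i hi
    rw [Finset.mem_range] at hi
    have hmono := π.mono i hi
    have hconst : f (π.t i) * (π.x (i + 1) - π.x i) = ∫ _ in π.x i..π.x (i + 1), f (π.t i) := by
      rw [intervalIntegral.integral_const, smul_eq_mul, mul_comm]
    rw [hconst, ← intervalIntegral.integral_sub intervalIntegrable_const (hint i hi),
      ← Real.norm_eq_abs, ← abs_of_nonneg (sub_nonneg.mpr hmono)]
    refine intervalIntegral.norm_integral_le_of_norm_le_const fun y hy => ?_
    rw [Set.uIoc_of_le hmono] at hy
    have htag := π.tag i hi
    have hmesh := π.sub_le_mesh_s1 hi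
    refine hg.2 k hk _ (hsub i hi htag) y (hsub i hi (Set.Ioc_subset_Icc_self hy)) ?_
    rw [abs_lt]
    constructor <;> linarith [hy.1, hy.2, htag.1, htag.2]
  calc _ ≤ _ := Finset.abs_sum_le_sum_abs _ _
    _ ≤ _ := Finset.sum_le_sum hterm
    _ = 1 / (k : ℝ) := by
      rw [← Finset.mul_sum, Finset.sum_range_sub, π.hx0, π.hxM, sub_zero, mul_one]

theorem CRI_ef (f : ℝ → ℝ) (g : ℕ → ℕ) (hg : ModUC g f) (n : ℕ) (hn : 1 ≤ n)
    (π π' : TaggedPartition)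
    (h1 : mesh π < 1 / (g (2 * n) : ℝ)) (h2 : mesh π' < 1 / (g (2 * n) : ℝ)) :
    |RSum f π - RSum f π'| ≤ 1 / (n : ℝ) := by
  have hk : 1 ≤ 2 * n := by omega
  have hπ := hg.abs_RSum_sub_integral_le hk π h1
  have hπ' := hg.abs_RSum_sub_integral_le hk π' h2
  rw [abs_sub_comm] at hπ'
  have hn0 : (n : ℝ) ≠ 0 := by exact_mod_cast (by omega : n ≠ 0)
  calc _ ≤ _ := abs_sub_le _ (∫ y in (0 : ℝ)..1, f y) _
    _ ≤ _ := add_le_add hπ hπ'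
    _ = 1 / (n : ℝ) := by
      push_cast
      field_simp
      norm_num
end

section
/- (Effective content of the reversal 'uniform monotone convergence theorem implies Feferman's mu-operator'.) Let t : (ℕ → ℝ) → (ℕ → ℕ) be a uniform modulus of convergence for bounded monotone sequences, i.e. for every sequence c : ℕ → ℝ with 0 ≤ c_n ≤ c_{n+1} ≤ 1 for all n, and for all k ≥ 1 and all N, M ≥ t(c)(k), one has |c_N − c_M| ≤ 1/k. Then for every f : ℕ → ℕ such that f(n) = 0 for some n, there exists n ≤ t(c_f)(2) with f(n) = 0, where c_f : ℕ → ℝ is defined by c_f(n) = 1 if f(i) = 0 for some i ≤ n, and c_f(n) = 0 otherwise. -/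
open Classical in
/-- The sequence associated to `f : ℕ → ℕ`: `cf f n = 1` if `f i = 0` for some `i ≤ n`,
and `cf f n = 0` otherwise. -/
noncomputable def cf (f : ℕ → ℕ) (n : ℕ) : ℝ :=
  if ∃ i ≤ n, f i = 0 then 1 else 0

theorem cf_eq_one {f : ℕ → ℕ} {i n : ℕ} (hi : i ≤ n) (hfi : f i = 0) : cf f n = 1 :=
  if_pos ⟨i, hi, hfi⟩

theorem cf_eq_zero {f : ℕ → ℕ} {n : ℕ} (h : ∀ i ≤ n, f i ≠ 0) : cf f n = 0 :=
  if_neg fun ⟨i, hi, hfi⟩ => h i hi hfi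

theorem cf_nonneg (f : ℕ → ℕ) (n : ℕ) : 0 ≤ cf f n := by
  unfold cf
  split_ifs <;> norm_num

theorem cf_le_one (f : ℕ → ℕ) (n : ℕ) : cf f n ≤ 1 := by
  unfold cf
  split_ifs <;> norm_num

theorem cf_le_succ (f : ℕ → ℕ) (n : ℕ) : cf f n ≤ cf f (n + 1) := by
  by_cases h : ∃ i ≤ n, f i = 0
  · obtain ⟨i, hi, hfi⟩ := h
    rw [cf_eq_one (Nat.le_succ_of_le hi) hfi]
    exact cf_le_one f n
  · push Not at h
    rw [cf_eq_zero h]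
    exact cf_nonneg f (n + 1)

theorem cf_monotone_bounded (f : ℕ → ℕ) (n : ℕ) :
    0 ≤ cf f n ∧ cf f n ≤ cf f (n + 1) ∧ cf f (n + 1) ≤ 1 :=
  ⟨cf_nonneg f n, cf_le_succ f n, cf_le_one f (n + 1)⟩

theorem UMCT_implies_mu (t : (ℕ → ℝ) → ℕ → ℕ)
    (ht : ∀ c : ℕ → ℝ, (∀ n, 0 ≤ c n ∧ c n ≤ c (n + 1) ∧ c (n + 1) ≤ 1) →
      ∀ k, 1 ≤ k → ∀ N M, t c k ≤ N → t c k ≤ M → |c N - c M| ≤ 1 / (k : ℝ))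
    (f : ℕ → ℕ) (hf : ∃ n, f n = 0) :
    ∃ n ≤ t (cf f) 2, f n = 0 := by
  obtain ⟨m, hm⟩ := hf
  by_contra! hne
  have h := ht (cf f) (cf_monotone_bounded f) 2 one_le_two (t (cf f) 2) (max (t (cf f) 2) m)
    le_rfl (le_max_left _ _)
  rw [cf_eq_zero hne, cf_eq_one (le_max_right _ m) hm] at h
  norm_num at h
end

section
/- For every functional g : (ℕ → ℕ) → ℕ there exists a finite list α₁, …, α_m of binary sequences such that every binary sequence β agrees with some αᵢ on all coordinates j < g(αᵢ), i.e. β(j) = αᵢ(j) for all j < g(αᵢ). (Note that g is not assumed continuous.) -/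
theorem herbrandised_fan (g : (ℕ → ℕ) → ℕ) :
    ∃ L : List (ℕ → ℕ), (∀ α ∈ L, ∀ n, α n ≤ 1) ∧
      ∀ β : ℕ → ℕ, (∀ n, β n ≤ 1) → ∃ α ∈ L, ∀ j < g α, β j = α j := by
  have hK : IsCompact (Set.univ.pi fun _ : ℕ => Set.Iic (1 : ℕ)) :=
    isCompact_univ_pi fun _ => (Set.finite_Iic 1).isCompact
  obtain ⟨t, ht, hcover⟩ := hK.elim_nhds_subcover
    (fun α => (Set.Iio (g α)).pi fun j => {α j})
    fun α _ => set_pi_mem_nhds (Set.finite_Iio _) fun j _ => by simp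
  refine ⟨t.toList, fun α hα n => ht α (Finset.mem_toList.1 hα) n trivial, fun β hβ => ?_⟩
  obtain ⟨α, hα, hβα⟩ := Set.mem_iUnion₂.1 (hcover fun n _ => hβ n)
  exact ⟨α, Finset.mem_toList.2 hα, fun j hj => hβα j hj⟩
end

section
/- (Existence of the special fan functional.) There exist functionals Θ₁ : ((ℕ → ℕ) → ℕ) → ℕ and Θ₂ : ((ℕ → ℕ) → ℕ) → List (ℕ → ℕ), with every member of each list Θ₂(g) a binary sequence, such that SCF(Θ₁, Θ₂) holds: for every g : (ℕ → ℕ) → ℕ and every set T of finite sequences of natural numbers, if for every α in the list Θ₂(g) the finite sequence ᾱ(g(α)) does not belong to T, then for every binary sequence β there exists i ≤ Θ₁(g) such that β̄i does not belong to T. -/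
/-- The restriction `ᾱm` of `α : ℕ → ℕ` to its first `m` values, as a finite sequence. -/
def restrict (α : ℕ → ℕ) (m : ℕ) : List ℕ := (List.range m).map α

/-- `SCF (Θ₁, Θ₂)`: for every `g` and every set `T` of finite sequences, if for every `α`
in the list `Θ₂ g` the finite sequence `ᾱ(g α)` is not in `T`, then for every binary
sequence `β` there is `i ≤ Θ₁ g` with `β̄i` not in `T`. -/
def SCF (Θ₁ : ((ℕ → ℕ) → ℕ) → ℕ) (Θ₂ : ((ℕ → ℕ) → ℕ) → List (ℕ → ℕ)) : Prop :=
  ∀ g : (ℕ → ℕ) → ℕ, ∀ T : Set (List ℕ),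
    (∀ α ∈ Θ₂ g, restrict α (g α) ∉ T) →
    ∀ β : ℕ → ℕ, (∀ n, β n ≤ 1) → ∃ i ≤ Θ₁ g, restrict β i ∉ T

theorem restrict_congr {α β : ℕ → ℕ} {m : ℕ} (h : ∀ i < m, β i = α i) :
    restrict β m = restrict α m :=
  List.map_congr_left fun i hi => h i (List.mem_range.mp hi)

/-- By compactness of Cantor space, finitely many of the neighbourhoods of binary sequences
prescribed by `g` cover all binary sequences. -/
theorem exists_finset_restrict_cover (g : (ℕ → ℕ) → ℕ) :
    ∃ t : Finset (ℕ → ℕ), (∀ α ∈ t, ∀ n, α n ≤ 1) ∧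
      ∀ β : ℕ → ℕ, (∀ n, β n ≤ 1) → ∃ α ∈ t, restrict β (g α) = restrict α (g α) := by
  have hcompact : IsCompact {β : ℕ → ℕ | ∀ n, β n ≤ 1} :=
    isCompact_pi_infinite fun _ => (Set.finite_Iic (1 : ℕ)).isCompact
  obtain ⟨t, ht, hcover⟩ := hcompact.elim_nhds_subcover
    (fun α => PiNat.cylinder (E := fun _ => ℕ) α (g α)) fun α _ =>
      (PiNat.isOpen_cylinder _ α (g α)).mem_nhds (PiNat.self_mem_cylinder α (g α))
  refine ⟨t, ht, fun β hβ => ?_⟩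
  obtain ⟨α, hα, hβα⟩ := Set.mem_iUnion₂.mp (hcover hβ)
  exact ⟨α, hα, restrict_congr hβα⟩

theorem special_fan_functional_exists :
    ∃ (Θ₁ : ((ℕ → ℕ) → ℕ) → ℕ) (Θ₂ : ((ℕ → ℕ) → ℕ) → List (ℕ → ℕ)),
      (∀ g, ∀ α ∈ Θ₂ g, ∀ n, α n ≤ 1) ∧ SCF Θ₁ Θ₂ := by
  choose t hbinary hcover using exists_finset_restrict_cover
  refine ⟨fun g => (t g).sup g, fun g => (t g).toList,
    fun g α hα => hbinary g α (Finset.mem_toList.mp hα), fun g T hT β hβ => ?_⟩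
  obtain ⟨α, hα, hβα⟩ := hcover g β hβ
  exact ⟨g α, Finset.le_sup hα, hβα ▸ hT α (Finset.mem_toList.mpr hα)⟩
end

section
/- (Stabilization of the canonical approximation of the Gandy–Hyland functional.) For every pointwise continuous Y : (ℕ → ℕ) → ℕ and every finite sequence s of natural numbers, the sequence M ↦ G(Y, s, M) is eventually constant: there exists N₀ such that G(Y, s, N) = G(Y, s, M) for all N, M ≥ N₀. -/
/-- `app s h` is the infinite sequence obtained by extending the finite sequence `s`
with the values of `h`, i.e. `s ⌢ h`.  In particular `app (s ++ [0]) h` is `s⌢⟨0⟩⌢h`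
and `app s (fun _ => 0)` is `s⌢0^ω`. -/
def app (s : List ℕ) (h : ℕ → ℕ) : ℕ → ℕ := fun n =>
  if hn : n < s.length then s[n] else h (n - s.length)

/-- `Y` is pointwise continuous on Baire space. -/
def PtwiseCont (Y : (ℕ → ℕ) → ℕ) : Prop :=
  ∀ f : ℕ → ℕ, ∃ N : ℕ, ∀ g : ℕ → ℕ, (∀ i < N, f i = g i) → Y f = Y g

/-- The canonical approximation `G(Y, s, M)` of the Gandy–Hyland functional:
`G(Y,s,M) = Y(s⌢0^ω)` if `|s| ≥ M`, and
`G(Y,s,M) = Y(s⌢⟨0⟩⌢(λ n. G(Y, s⌢⟨n+1⟩, M)))` otherwise. -/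
def G (Y : (ℕ → ℕ) → ℕ) (s : List ℕ) (M : ℕ) : ℕ :=
  if h : M ≤ s.length then Y (app s fun _ => 0)
  else Y (app (s ++ [0]) fun n => G Y (s ++ [n + 1]) M)
termination_by M - s.length
decreasing_by
  simp only [List.length_append, List.length_cons, List.length_nil]
  omega

/-- `γ` satisfies the Gandy–Hyland equation for `Y`. -/
def GHEq (Y : (ℕ → ℕ) → ℕ) (γ : List ℕ → ℕ) : Prop :=
  ∀ s : List ℕ, γ s = Y (app (s ++ [0]) fun n => γ (s ++ [n + 1]))

theorem app_of_lt {s : List ℕ} {i : ℕ} (hi : i < s.length) (h : ℕ → ℕ) : app s h i = s[i] := by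
  simp [app, hi]

theorem app_append_of_lt {s : List ℕ} {i : ℕ} (hi : i < s.length) (u : List ℕ) (h : ℕ → ℕ) :
    app (s ++ u) h i = s[i] := by
  rw [app_of_lt (by simp; omega), List.getElem_append_left hi]

/-- If `Y` is constant on the sequences extending `s`, then `G Y s` takes that constant value. -/
theorem G_eq_of_forall_extends {Y : (ℕ → ℕ) → ℕ} {s : List ℕ} {c : ℕ}
    (hc : ∀ g : ℕ → ℕ, (∀ i (hi : i < s.length), g i = s[i]) → Y g = c) (M : ℕ) :
    G Y s M = c := by
  rw [G]
  split
  · exact hc _ fun i hi => app_of_lt hi _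
  · exact hc _ fun i hi => app_append_of_lt hi _ _

/-- Stabilization at all the immediate extensions of `s` by a positive number gives
stabilization at `s`. -/
theorem exists_G_eq_of_forall_append {Y : (ℕ → ℕ) → ℕ} (hY : PtwiseCont Y) {s : List ℕ}
    (hs : ∀ n, ∃ c N₀, ∀ N, N₀ ≤ N → G Y (s ++ [n + 1]) N = c) :
    ∃ c N₀, ∀ N, N₀ ≤ N → G Y s N = c := by
  choose h B hB using hs
  obtain ⟨K, hK⟩ := hY (app (s ++ [0]) h)
  refine ⟨Y (app (s ++ [0]) h), (Finset.range K).sup B + s.length + 1, fun N hN => ?_⟩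
  rw [G, dif_neg (by omega)]
  refine (hK _ fun i hi => ?_).symm
  unfold app
  split
  · rfl
  · refine (hB _ N ?_).symm
    have : B (i - (s ++ [0]).length) ≤ (Finset.range K).sup B :=
      Finset.le_sup (Finset.mem_range.2 (by omega))
    omega

/-- The `k`-th list obtained from `s` by repeatedly appending the entry chosen by `e`. -/
def iterAppend (e : List ℕ → ℕ) (s : List ℕ) : ℕ → List ℕ
  | 0 => s
  | k + 1 => iterAppend e s k ++ [e (iterAppend e s k)]

theorem length_iterAppend (e : List ℕ → ℕ) (s : List ℕ) (k : ℕ) :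
    (iterAppend e s k).length = s.length + k := by
  induction k with
  | zero => rfl
  | succ k ih => simp [iterAppend, ih, add_assoc]

theorem iterAppend_prefix (e : List ℕ → ℕ) (s : List ℕ) {j k : ℕ} (h : j ≤ k) :
    iterAppend e s j <+: iterAppend e s k := by
  induction k, h using Nat.le_induction with
  | base => exact List.prefix_rfl
  | succ k _ ih => exact ih.trans (List.prefix_append _ _)

theorem exists_forall_iterAppend_getElem (e : List ℕ → ℕ) (s : List ℕ) :
    ∃ f : ℕ → ℕ, ∀ k i (hi : i < (iterAppend e s k).length), (iterAppend e s k)[i] = f i := by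
  have hlt (i : ℕ) : i < (iterAppend e s (i + 1)).length := by
    rw [length_iterAppend]; omega
  refine ⟨fun i => (iterAppend e s (i + 1))[i]'(hlt i), fun k i hi => ?_⟩
  rcases le_total k (i + 1) with h | h
  · exact (iterAppend_prefix e s h).getElem hi
  · exact ((iterAppend_prefix e s h).getElem (hlt i)).symm

theorem exists_G_eq {Y : (ℕ → ℕ) → ℕ} (hY : PtwiseCont Y) (s : List ℕ) :
    ∃ c N₀, ∀ N, N₀ ≤ N → G Y s N = c := by
  by_contra hs
  have step (t : List ℕ) : ∃ m, (¬ ∃ c N₀, ∀ N, N₀ ≤ N → G Y t N = c) →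
      ¬ ∃ c N₀, ∀ N, N₀ ≤ N → G Y (t ++ [m]) N = c := by
    by_contra! h
    obtain ⟨ht, -⟩ := h 0
    obtain ⟨c, N₀, hc⟩ := exists_G_eq_of_forall_append hY fun n => (h (n + 1)).2
    obtain ⟨N, hN, hne⟩ := ht c N₀
    exact hne (hc N hN)
  choose e he using step
  have hbad (k : ℕ) : ¬ ∃ c N₀, ∀ N, N₀ ≤ N → G Y (iterAppend e s k) N = c := by
    induction k with
    | zero => exact hs
    | succ k ih => exact he _ ih
  obtain ⟨f, hf⟩ := exists_forall_iterAppend_getElem e s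
  obtain ⟨K, hK⟩ := hY f
  refine hbad K ⟨Y f, 0, fun N _ => G_eq_of_forall_extends (fun g hg => ?_) N⟩
  refine (hK g fun i hi => ?_).symm
  have hi' : i < (iterAppend e s K).length := by rw [length_iterAppend]; omega
  rw [hg i hi', hf]

theorem G_eventually_constant (Y : (ℕ → ℕ) → ℕ) (hY : PtwiseCont Y) (s : List ℕ) :
    ∃ N₀ : ℕ, ∀ N M : ℕ, N₀ ≤ N → N₀ ≤ M → G Y s N = G Y s M := by
  obtain ⟨c, N₀, h⟩ := exists_G_eq hY s
  exact ⟨N₀, fun N M hN hM => (h N hN).trans (h M hM).symm⟩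
end

section
/- (Existence of the Gandy–Hyland functional on continuous arguments.) There exists a functional Γ : ((ℕ → ℕ) → ℕ) → (List ℕ) → ℕ such that for every pointwise continuous Y : (ℕ → ℕ) → ℕ, the function Γ(Y, ·) satisfies the Gandy–Hyland equation for Y, i.e. for every finite sequence s of natural numbers, Γ(Y, s) = Y(s⌢⟨0⟩⌢(λn. Γ(Y, s⌢⟨n+1⟩))). -/
theorem app_append (s t : List ℕ) (h : ℕ → ℕ) : app (s ++ t) h = app s (app t h) := by
  funext n
  simp only [app, List.length_append, List.getElem_append]
  split_ifs <;> first | rfl | omega | (congr 1; omega)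

theorem app_singleton_shift (h : ℕ → ℕ) : app [h 0] (fun n => h (n + 1)) = h := by
  funext n
  cases n <;> simp [app]

theorem app_apply_of_lt {s : List ℕ} {i : ℕ} (hi : i < s.length) (g h : ℕ → ℕ) :
    app s g i = app s h i := by
  simp [app, hi]

/-- `Y` is constant on the basic open set of sequences extending `s`. -/
def ConstOn (Y : (ℕ → ℕ) → ℕ) (s : List ℕ) : Prop :=
  ∀ g h : ℕ → ℕ, Y (app s g) = Y (app s h)

/-- `t` is a child `s⌢⟨n+1⟩` of a node `s` on which `Y` is not yet constant. -/
def UnsecuredChild (Y : (ℕ → ℕ) → ℕ) (t s : List ℕ) : Prop :=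
  ¬ ConstOn Y s ∧ ∃ n, t = s ++ [n + 1]

theorem PtwiseCont.wellFounded_unsecuredChild {Y : (ℕ → ℕ) → ℕ} (hY : PtwiseCont Y) :
    WellFounded (UnsecuredChild Y) := by
  refine wellFounded_iff_isEmpty_descending_chain.2 ⟨fun ⟨u, hu⟩ => ?_⟩
  choose hconst c hc using hu
  have hlen : ∀ k, k ≤ (u k).length := fun k => by
    induction k with
    | zero => exact Nat.zero_le _
    | succ k ih => simpa [hc] using ih
  have hlim : ∀ k, app (u k) (fun j => c (k + j) + 1) = app (u 0) fun j => c j + 1 := fun k => by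
    induction k with
    | zero => simp
    | succ k ih =>
      rw [← ih, hc, app_append, ← app_singleton_shift fun j => c (k + j) + 1]
      simp only [Nat.add_zero, Nat.add_assoc, Nat.add_comm 1]
  obtain ⟨N, hN⟩ := hY (app (u 0) fun j => c j + 1)
  have key : ∀ g, Y (app (u 0) fun j => c j + 1) = Y (app (u N) g) := fun g =>
    hN _ fun i hi => by
      rw [← hlim N]
      exact app_apply_of_lt (hi.trans_le (hlen N)) _ _
  exact hconst N fun g h => (key g).symm.trans (key h)

theorem PtwiseCont.exists_ghEq {Y : (ℕ → ℕ) → ℕ} (hY : PtwiseCont Y) : ∃ γ, GHEq Y γ := by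
  classical
  let F (s : List ℕ) (rec : ∀ t, UnsecuredChild Y t s → ℕ) : ℕ :=
    Y (app (s ++ [0]) fun n =>
      if hs : ConstOn Y s then 0 else rec (s ++ [n + 1]) ⟨hs, n, rfl⟩)
  refine ⟨hY.wellFounded_unsecuredChild.fix F, fun s => ?_⟩
  rw [WellFounded.fix_eq]
  by_cases hs : ConstOn Y s
  · simp only [F, app_append]
    exact hs _ _
  · simp only [F, dif_neg hs]

theorem gandy_hyland_exists :
    ∃ Γ : ((ℕ → ℕ) → ℕ) → List ℕ → ℕ,
      ∀ Y : (ℕ → ℕ) → ℕ, PtwiseCont Y → GHEq Y (Γ Y) := by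
  classical
  exact ⟨fun Y => if hY : PtwiseCont Y then hY.exists_ghEq.choose else fun _ => 0,
    fun Y hY => by simpa only [dif_pos hY] using hY.exists_ghEq.choose_spec⟩
end
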